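/- For every f ∈ GL(V₂,v₁), the automorphism Φ(f) of W(2) given by (Φ(f)(A))(x,y) = f(A(f⁻¹(x), f⁻¹(y))) maps the subalgebra W₂ onto itself, and the induced group homomorphism GL(V₂,v₁) → Aut(W₂) is bijective: every algebra automorphism of W₂ is the restriction of Φ(f) for exactly one f ∈ GL(V₂) with f(v₁) = v₁. -/

import Mathlib

noncomputable section

variable (F : Type*) [Field F] [CharZero F]

abbrev V2 (F : Type*) [Field F] : Type _ := Fin 2 → F

abbrev WW (F : Type*) [Field F] : Type _ := V2 F →ₗ[F] V2 F →ₗ[F] V2 F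

def vone : V2 F := ![1, 0]

/-- The multiplication on the space of bilinear maps. -/
def wmul (A B : WW F) : WW F :=
  LinearMap.mk₂ F
    (fun x y => A (vone F) (B x y) - B (A (vone F) x) y - B x (A (vone F) y))
    (fun x x' y => by simp only [map_add, LinearMap.add_apply]; abel)
    (fun c x y => by simp only [map_smul, LinearMap.smul_apply, smul_sub])
    (fun x y y' => by simp only [map_add, LinearMap.add_apply]; abel)
    (fun c x y => by simp only [map_smul, LinearMap.smul_apply, smul_sub])

/-- α_{ij}^k -/
def alphaM (i j k : Fin 2) : WW F :=
  LinearMap.mk₂ F (fun x y => (x i * y j) • (Pi.single k (1 : F) : V2 F))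
    (fun x x' y => by simp [add_mul, add_smul])
    (fun c x y => by simp [smul_smul, mul_assoc])
    (fun x y y' => by simp [mul_add, add_smul])
    (fun c x y => by simp [smul_smul, mul_assoc, mul_left_comm])

/-- The basis e₁, …, e₈ of W(2) (indexed 0,…,7). -/
def bE : Fin 8 → WW F :=
  ![alphaM F 0 0 0 - alphaM F 0 1 1 - alphaM F 1 0 1,
    alphaM F 0 0 1,
    alphaM F 1 1 1 - alphaM F 0 1 0 - alphaM F 1 0 0,
    alphaM F 1 1 0,
    (2 : F) • alphaM F 0 0 0 + alphaM F 0 1 1 + alphaM F 1 0 1,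
    (2 : F) • alphaM F 1 1 1 + alphaM F 0 1 0 + alphaM F 1 0 0,
    alphaM F 0 1 0 - alphaM F 1 0 0,
    alphaM F 0 1 1 - alphaM F 1 0 1]


/-- Φ(f) : W(2) → W(2), A ↦ ((x,y) ↦ f(A(f⁻¹x, f⁻¹y))). -/
def PsiMap (f : V2 F ≃ₗ[F] V2 F) : WW F ≃ₗ[F] WW F :=
  LinearEquiv.arrowCongr f (LinearEquiv.arrowCongr f f)

/-- W₂ = span{e₁, …, e₆}, the algebra of commutative multiplications on V₂. -/
def W2span : Submodule F (WW F) :=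
  Submodule.span F {bE F 0, bE F 1, bE F 2, bE F 3, bE F 4, bE F 5}

open Matrix

section
variable {F}

set_option linter.unusedSectionVars false

lemma vone_apply_zero : vone F 0 = 1 := rfl
lemma vone_apply_one : vone F 1 = 0 := rfl

/-- The second standard basis vector of `V2 F`. -/
def vtwo (F : Type*) [Field F] : V2 F := ![0, 1]

lemma vtwo_apply_one : vtwo F 1 = 1 := rfl

lemma eq_smul_add_smul (x : V2 F) : x = x 0 • vone F + x 1 • vtwo F := by
  ext i; fin_cases i <;> simp [vone, vtwo]

/-- The symmetric bilinear map with prescribed values on the standard basis. -/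
def symOf (u v w : V2 F) : WW F :=
  LinearMap.mk₂ F
    (fun x y => (x 0 * y 0) • u + (x 0 * y 1 + x 1 * y 0) • v + (x 1 * y 1) • w)
    (fun x x' y => by simp only [Pi.add_apply]; module)
    (fun c x y => by simp only [Pi.smul_apply, smul_eq_mul]; module)
    (fun x y y' => by simp only [Pi.add_apply]; module)
    (fun c x y => by simp only [Pi.smul_apply, smul_eq_mul]; module)

lemma symOf_apply (u v w x y : V2 F) :
    symOf u v w x y = (x 0 * y 0) • u + (x 0 * y 1 + x 1 * y 0) • v + (x 1 * y 1) • w := rfl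

lemma symOf_mem (u v w : V2 F) : symOf u v w ∈ W2span F := by
  have h : symOf u v w = ((u 0 - 2 * v 1) / 3) • bE F 0 + u 1 • bE F 1
      + ((w 1 - 2 * v 0) / 3) • bE F 2 + w 0 • bE F 3
      + ((u 0 + v 1) / 3) • bE F 4 + ((w 1 + v 0) / 3) • bE F 5 := by
    refine LinearMap.ext fun x => LinearMap.ext fun y => ?_
    ext i
    fin_cases i <;> simp [symOf_apply, bE, alphaM] <;> field_simp <;> ring
  rw [h]
  have hb : ∀ i : Fin 8, bE F i ∈ ({bE F 0, bE F 1, bE F 2, bE F 3, bE F 4, bE F 5} : Set (WW F))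
      → bE F i ∈ W2span F := fun i hi => Submodule.subset_span hi
  refine add_mem (add_mem (add_mem (add_mem (add_mem ?_ ?_) ?_) ?_) ?_) ?_ <;>
    exact Submodule.smul_mem _ _ (hb _ (by simp))

lemma symm_of_mem {A : WW F} (hA : A ∈ W2span F) (x y : V2 F) : A x y = A y x := by
  induction hA using Submodule.span_induction with
  | mem A hA =>
    simp only [Set.mem_insert_iff, Set.mem_singleton_iff] at hA
    rcases hA with rfl | rfl | rfl | rfl | rfl | rfl <;> ext i <;> fin_cases i <;>
      simp [bE, alphaM] <;> ring
  | zero => simp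
  | add A B _ _ hA hB => simp [hA, hB]
  | smul c A _ hA => simp [hA]

lemma mem_of_symm {A : WW F} (hA : ∀ x y, A x y = A y x) : A ∈ W2span F := by
  have h : A = symOf (A (vone F) (vone F)) (A (vone F) (vtwo F)) (A (vtwo F) (vtwo F)) := by
    refine LinearMap.ext fun x => LinearMap.ext fun y => ?_
    conv_lhs => rw [eq_smul_add_smul x, eq_smul_add_smul y]
    simp only [map_add, map_smul, LinearMap.add_apply, LinearMap.smul_apply, symOf_apply,
      hA (vtwo F) (vone F)]
    module
  rw [h]
  exact symOf_mem _ _ _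

lemma eq_zero_of_mem {A : WW F} (hA : A ∈ W2span F) (h1 : A (vone F) = 0)
    (h2 : A (vtwo F) (vtwo F) = 0) : A = 0 := by
  refine LinearMap.ext fun x => LinearMap.ext fun y => ?_
  rw [eq_smul_add_smul x, eq_smul_add_smul y]
  simp [h1, h2, symm_of_mem hA (vtwo F) (vone F)]

lemma PsiMap_apply (f : V2 F ≃ₗ[F] V2 F) (A : WW F) (x y : V2 F) :
    PsiMap F f A x y = f (A (f.symm x) (f.symm y)) := rfl

lemma PsiMap_mem (f : V2 F ≃ₗ[F] V2 F) {A : WW F} (hA : A ∈ W2span F) :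
    PsiMap F f A ∈ W2span F :=
  mem_of_symm fun x y => by rw [PsiMap_apply, PsiMap_apply, symm_of_mem hA]

lemma map_PsiMap_W2span (f : V2 F ≃ₗ[F] V2 F) :
    Submodule.map (PsiMap F f).toLinearMap (W2span F) = W2span F := by
  apply le_antisymm
  · rintro _ ⟨A, hA, rfl⟩
    exact PsiMap_mem f hA
  · intro A hA
    refine ⟨PsiMap F f.symm A, PsiMap_mem f.symm hA, ?_⟩
    refine LinearMap.ext fun x => LinearMap.ext fun y => ?_
    simp [PsiMap_apply]

/-- The natural action of `gl₂` on bilinear maps. -/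
def act (M : Matrix (Fin 2) (Fin 2) F) (B : WW F) : WW F :=
  B.compr₂ M.toLin' - B.compl₁₂ M.toLin' LinearMap.id - B.compl₁₂ LinearMap.id M.toLin'

lemma act_apply (M : Matrix (Fin 2) (Fin 2) F) (B : WW F) (x y : V2 F) :
    act M B x y = M *ᵥ B x y - B (M *ᵥ x) y - B x (M *ᵥ y) := by
  simp [act]

lemma act_mem (M : Matrix (Fin 2) (Fin 2) F) {B : WW F} (hB : B ∈ W2span F) :
    act M B ∈ W2span F :=
  mem_of_symm fun x y => by
    rw [act_apply, act_apply, symm_of_mem hB x y, symm_of_mem hB (M *ᵥ x) y,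
      symm_of_mem hB x (M *ᵥ y)]
    abel

lemma act_lie_add (M N : Matrix (Fin 2) (Fin 2) F) (B : WW F) :
    act ⁅M, N⁆ B + act N (act M B) = act M (act N B) := by
  refine LinearMap.ext fun x => LinearMap.ext fun y => ?_
  simp only [act_apply, LinearMap.add_apply, Ring.lie_def, sub_mulVec, mulVec_sub, map_sub,
    LinearMap.sub_apply, ← mulVec_mulVec]
  abel

lemma act_one (B : WW F) : act 1 B = (-1 : F) • B := by
  refine LinearMap.ext fun x => LinearMap.ext fun y => ?_
  simp [act_apply]

lemma act_injective {M N : Matrix (Fin 2) (Fin 2) F}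
    (h : ∀ B ∈ W2span F, act M B = act N B) : M = N := by
  have key : ∀ u v w x y : V2 F, act M (symOf u v w) x y = act N (symOf u v w) x y :=
    fun u v w x y => by rw [h _ (symOf_mem u v w)]
  have h1 := congrFun (key (vone F) 0 0 (vtwo F) (vone F)) 0
  have h2 := congrFun (key (vone F) 0 0 (vone F) (vone F)) 0
  have h3 := congrFun (key (vone F) 0 0 (vone F) (vone F)) 1
  have h4 := congrFun (key 0 0 (vtwo F) (vtwo F) (vtwo F)) 1
  simp [act_apply, symOf_apply, vone, vtwo] at h1 h2 h3 h4
  ext i j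
  fin_cases i <;> fin_cases j
  · exact h2
  · exact h1
  · exact h3
  · exact h4

/-- The matrix of `A(v₁, ·)`. -/
def rho : WW F →ₗ[F] Matrix (Fin 2) (Fin 2) F :=
  LinearMap.toMatrix'.toLinearMap ∘ₗ LinearMap.applyₗ (vone F)

lemma rho_apply (A : WW F) : rho A = LinearMap.toMatrix' (A (vone F)) := rfl

lemma rho_mulVec (A : WW F) (x : V2 F) : rho A *ᵥ x = A (vone F) x := by
  rw [rho_apply, LinearMap.toMatrix'_mulVec]

lemma wmul_eq_act (A B : WW F) : wmul F A B = act (rho A) B := by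
  refine LinearMap.ext fun x => LinearMap.ext fun y => ?_
  rw [act_apply]
  simp only [rho_mulVec]
  rfl

/-- The linear section of `rho` with values in the symmetric maps vanishing at `(v₂, v₂)`. -/
def sec : Matrix (Fin 2) (Fin 2) F →ₗ[F] W2span F where
  toFun M := ⟨symOf (M *ᵥ vone F) (M *ᵥ vtwo F) 0, symOf_mem _ _ _⟩
  map_add' M N := by
    refine Subtype.ext (LinearMap.ext fun x => LinearMap.ext fun y => ?_)
    simp only [symOf_apply, add_mulVec, Submodule.coe_add, LinearMap.add_apply]
    module
  map_smul' c M := by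
    refine Subtype.ext (LinearMap.ext fun x => LinearMap.ext fun y => ?_)
    simp only [symOf_apply, smul_mulVec, Submodule.coe_smul, LinearMap.smul_apply, RingHom.id_apply]
    module

lemma rho_sec (M : Matrix (Fin 2) (Fin 2) F) : rho (sec M : WW F) = M := by
  apply Matrix.toLin'.injective
  refine LinearMap.ext fun x => ?_
  rw [toLin'_apply, rho_mulVec, toLin'_apply]
  conv_rhs => rw [eq_smul_add_smul x]
  simp [sec, symOf_apply, vone_apply_zero, vone_apply_one, mulVec_add, mulVec_smul]

end

section
variable {F}

set_option linter.unusedSectionVars false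

/-- The action of `gl₂` on symmetric bilinear maps. -/
def symAct (M : Matrix (Fin 2) (Fin 2) F) (B : W2span F) : W2span F :=
  ⟨act M B.1, act_mem M B.2⟩

/-- The linear map of `gl₂` induced by a linear map of `W2span F`. -/
def theta (g : W2span F ≃ₗ[F] W2span F) :
    Matrix (Fin 2) (Fin 2) F →ₗ[F] Matrix (Fin 2) (Fin 2) F :=
  rho ∘ₗ (W2span F).subtype ∘ₗ g.toLinearMap ∘ₗ sec

lemma theta_apply (g : W2span F ≃ₗ[F] W2span F) (M : Matrix (Fin 2) (Fin 2) F) :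
    theta g M = rho (g (sec M) : WW F) := rfl

/-- `g` respects the multiplication `wmul` of `W2span F`. -/
def IsMulHom (g : W2span F ≃ₗ[F] W2span F) : Prop :=
  ∀ a b c : W2span F, wmul F a.1 b.1 = c.1 → wmul F (g a).1 (g b).1 = (g c).1

variable {g : W2span F ≃ₗ[F] W2span F}

lemma IsMulHom.map_act (hg : IsMulHom g) (M : Matrix (Fin 2) (Fin 2) F) (B : W2span F) :
    (g (symAct M B)).1 = act (theta g M) (g B).1 := by
  rw [theta_apply, ← wmul_eq_act]
  refine (hg _ _ _ ?_).symm
  rw [wmul_eq_act, rho_sec]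
  rfl

lemma IsMulHom.eq_theta (hg : IsMulHom g) {M N : Matrix (Fin 2) (Fin 2) F}
    (h : ∀ B : W2span F, (g (symAct M B)).1 = act N (g B).1) : theta g M = N := by
  refine act_injective fun B hB => ?_
  obtain ⟨C, hC⟩ := g.surjective ⟨B, hB⟩
  have hC' : B = (g C).1 := by rw [hC]
  rw [hC', ← hg.map_act, h]

lemma IsMulHom.theta_lie (hg : IsMulHom g) (M N : Matrix (Fin 2) (Fin 2) F) :
    theta g ⁅M, N⁆ = ⁅theta g M, theta g N⁆ := by
  refine hg.eq_theta fun B => ?_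
  have h : symAct ⁅M, N⁆ B + symAct N (symAct M B) = symAct M (symAct N B) :=
    Subtype.ext (act_lie_add M N B.1)
  have h' := congrArg (fun C => (g C).1) h
  simp only [map_add, Submodule.coe_add, hg.map_act, ← act_lie_add (theta g M)] at h'
  rw [hg.map_act]
  refine LinearMap.ext fun x => LinearMap.ext fun y => ?_
  exact add_right_cancel (LinearMap.congr_fun (LinearMap.congr_fun h' x) y)

lemma IsMulHom.theta_one (hg : IsMulHom g) : theta g 1 = 1 := by
  refine hg.eq_theta fun B => ?_
  have h : symAct 1 B = (-1 : F) • B := Subtype.ext (act_one B.1)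
  rw [h, map_smul, act_one]
  rfl

lemma IsMulHom.theta_injective (hg : IsMulHom g) : Function.Injective (theta g) := by
  intro M N hMN
  refine act_injective fun B hB => ?_
  have h := hg.map_act M ⟨B, hB⟩
  rw [hMN, ← hg.map_act] at h
  exact congrArg Subtype.val (g.injective (Subtype.ext h))

lemma IsMulHom.theta_rho (hg : IsMulHom g) (A : W2span F) :
    theta g (rho A.1) = rho (g A).1 :=
  hg.eq_theta fun B => by
    rw [← wmul_eq_act]
    exact (hg _ _ _ (wmul_eq_act _ _)).symm

lemma act_of_apply_vone_eq_zero (M : Matrix (Fin 2) (Fin 2) F) {B : WW F}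
    (h : B (vone F) = 0) (y : V2 F) :
    act M B (vone F) y = -(M 1 0) • B (vtwo F) y := by
  have hM : M *ᵥ vone F = M 0 0 • vone F + M 1 0 • vtwo F := by
    ext i; fin_cases i <;> simp [vone, vtwo]
  simp [act_apply, h, hM]

lemma rho_eq_zero_iff {A : WW F} : rho A = 0 ↔ A (vone F) = 0 := by
  constructor
  · intro h
    refine LinearMap.ext fun x => ?_
    rw [← rho_mulVec, h, zero_mulVec]; rfl
  · intro h
    simp [rho_apply, h]

lemma IsMulHom.apply_vone_eq_zero (hg : IsMulHom g) {k : W2span F} (hk : k.1 (vone F) = 0) :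
    (g k).1 (vone F) = 0 := by
  rw [← rho_eq_zero_iff, ← hg.theta_rho, rho_eq_zero_iff.2 hk, map_zero]

/-- A symmetric map in the kernel of `rho`. -/
def kerElt (w : V2 F) : W2span F := ⟨symOf 0 0 w, symOf_mem _ _ _⟩

lemma kerElt_apply (w x y : V2 F) : (kerElt w).1 x y = (x 1 * y 1) • w := by
  simp [kerElt, symOf_apply]

lemma kerElt_vone (w : V2 F) : (kerElt w).1 (vone F) = 0 := by
  refine LinearMap.ext fun y => ?_
  simp [kerElt_apply, vone_apply_one]

lemma IsMulHom.map_kerElt_ne_zero (hg : IsMulHom g) {w : V2 F} (hw : w ≠ 0) :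
    (g (kerElt w)).1 (vtwo F) (vtwo F) ≠ 0 := by
  intro h
  have h0 := eq_zero_of_mem (g (kerElt w)).2 (hg.apply_vone_eq_zero (kerElt_vone w)) h
  have h1 : kerElt w = 0 := g.map_eq_zero_iff.1 (Subtype.ext h0)
  have h2 := kerElt_apply w (vtwo F) (vtwo F)
  rw [h1] at h2
  apply hw
  simpa [vtwo_apply_one] using h2.symm

lemma IsMulHom.theta_apply_one_zero (hg : IsMulHom g) {M : Matrix (Fin 2) (Fin 2) F}
    (hM : M 1 0 = 0) : theta g M 1 0 = 0 := by
  have hk := kerElt_vone (vone F)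
  have hne : vone F ≠ 0 := fun h => one_ne_zero (congrFun h 0)
  have h1 : (symAct M (kerElt (vone F))).1 (vone F) = 0 := by
    refine LinearMap.ext fun y => ?_
    exact (act_of_apply_vone_eq_zero M hk y).trans (by simp [hM])
  have h2 := hg.apply_vone_eq_zero h1
  rw [hg.map_act] at h2
  have h3 := act_of_apply_vone_eq_zero (theta g M)
    (hg.apply_vone_eq_zero hk) (vtwo F)
  rw [h2] at h3
  have h4 := (smul_eq_zero.1 h3.symm).resolve_right (hg.map_kerElt_ne_zero hne)
  exact neg_eq_zero.1 h4

lemma act_of_borel {M : Matrix (Fin 2) (Fin 2) F} (hM : M 1 0 = 0) {B : WW F}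
    (hB : B ∈ W2span F) (h : B (vone F) = 0) :
    act M B (vtwo F) (vtwo F) = ![(M 0 0 - 2 * M 1 1) * B (vtwo F) (vtwo F) 0
      + M 0 1 * B (vtwo F) (vtwo F) 1, -M 1 1 * B (vtwo F) (vtwo F) 1] := by
  have hv : M *ᵥ vtwo F = M 0 1 • vone F + M 1 1 • vtwo F := by
    ext i; fin_cases i <;> simp [vone, vtwo]
  have h' : B (vtwo F) (vone F) = 0 := by rw [symm_of_mem hB, h]; rfl
  simp only [act_apply, hv, map_add, map_smul, LinearMap.add_apply, LinearMap.smul_apply, h, h']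
  generalize B (vtwo F) (vtwo F) = u
  ext i
  fin_cases i
  · simp only [Fin.zero_eta, Pi.sub_apply, mulVec, dotProduct, Fin.sum_univ_two, Pi.add_apply,
      Pi.smul_apply, smul_eq_mul, cons_val_zero, LinearMap.zero_apply, Pi.zero_apply]
    ring
  · simp only [Fin.mk_one, Pi.sub_apply, mulVec, dotProduct, Fin.sum_univ_two, Pi.add_apply,
      Pi.smul_apply, smul_eq_mul, cons_val_one, LinearMap.zero_apply, Pi.zero_apply, hM,
      cons_val_fin_one]
    ring

lemma IsMulHom.theta_diag (hg : IsMulHom g)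
    (h : theta g !![1, 0; 0, 0] 0 0 = 1 + theta g !![1, 0; 0, 0] 1 1) :
    theta g !![1, 0; 0, 0] 1 1 = 0 := by
  set N := theta g !![1, 0; 0, 0] with hN
  have hN0 : N 1 0 = 0 := hg.theta_apply_one_zero (by simp)
  have key : ∀ (c : F) (w : V2 F), symAct !![1, 0; 0, 0] (kerElt w) = c • kerElt w →
      ![(N 0 0 - 2 * N 1 1) * (g (kerElt w)).1 (vtwo F) (vtwo F) 0
      + N 0 1 * (g (kerElt w)).1 (vtwo F) (vtwo F) 1,
      -N 1 1 * (g (kerElt w)).1 (vtwo F) (vtwo F) 1]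
      = c • (g (kerElt w)).1 (vtwo F) (vtwo F) := by
    intro c w hw
    rw [← act_of_borel hN0 (g (kerElt w)).2 (hg.apply_vone_eq_zero (kerElt_vone w)),
      hN, ← hg.map_act, hw, map_smul]
    rfl
  have hE : ∀ w : V2 F, symAct !![1, 0; 0, 0] (kerElt w) = kerElt ![w 0, 0] := by
    intro w
    refine Subtype.ext (LinearMap.ext fun x => LinearMap.ext fun y => ?_)
    change act _ (kerElt w).1 x y = _
    ext i; fin_cases i <;> simp [act_apply, kerElt_apply, vecHead]
  have k1 := key 1 (vone F) (by rw [hE, one_smul]; rfl)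
  have k0 := key 0 (vtwo F) (by
    rw [hE, zero_smul]
    refine Subtype.ext (LinearMap.ext fun x => LinearMap.ext fun y => ?_)
    ext i; fin_cases i <;> simp [kerElt_apply, vtwo])
  have n1 := hg.map_kerElt_ne_zero (w := vone F) fun h => one_ne_zero (congrFun h 0)
  have n0 := hg.map_kerElt_ne_zero (w := vtwo F) fun h => one_ne_zero (congrFun h 1)
  generalize (g (kerElt (vone F))).1 (vtwo F) (vtwo F) = u at k1 n1
  generalize (g (kerElt (vtwo F))).1 (vtwo F) (vtwo F) = v at k0 n0
  have a0 := congrFun k1 0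
  have a1 := congrFun k1 1
  have b0 := congrFun k0 0
  have b1 := congrFun k0 1
  simp [h] at a0 a1 b0 b1
  by_contra hd
  have hv1 : v 1 = 0 := b1.resolve_left hd
  have hv0 : v 0 ≠ 0 := fun hv0 => n0 (by ext i; fin_cases i <;> simp [hv0, hv1])
  have hd1 : N 1 1 = 1 := by
    rw [hv1] at b0
    have : (1 - N 1 1) * v 0 = 0 := by linear_combination b0
    linear_combination -(mul_eq_zero.1 this).resolve_right hv0
  have hu1 : u 1 = 0 := by
    rw [hd1] at a1
    have : (2 : F) * u 1 = 0 := by linear_combination -a1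
    simpa using this
  have hu0 : u 0 ≠ 0 := fun hu0 => n1 (by ext i; fin_cases i <;> simp [hu0, hu1])
  rw [hd1, hu1] at a0
  exact hu0 (by linear_combination -a0)

/-- A Lie automorphism of `gl₂` that stabilises the Borel subalgebra and fixes the diagonal modulo
its nilradical is conjugation by an upper triangular matrix fixing the first basis vector. -/
lemma exists_conj (θ : Matrix (Fin 2) (Fin 2) F →ₗ[F] Matrix (Fin 2) (Fin 2) F)
    (hlie : ∀ M N, θ ⁅M, N⁆ = ⁅θ M, θ N⁆) (hinj : Function.Injective θ) (hone : θ 1 = 1)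
    (hborel : ∀ M, M 1 0 = 0 → θ M 1 0 = 0)
    (hdiag : θ !![1, 0; 0, 0] 0 0 = 1 + θ !![1, 0; 0, 0] 1 1 → θ !![1, 0; 0, 0] 1 1 = 0) :
    ∃ P : Matrix (Fin 2) (Fin 2) F, IsUnit P.det ∧ P *ᵥ vone F = vone F ∧
      ∀ M, θ M * P = P * M := by
  have c1 : ⁅(!![1, 0; 0, 0] : Matrix (Fin 2) (Fin 2) F), (!![0, 1; 0, 0] : Matrix (Fin 2) (Fin 2) F)⁆
      = !![0, 1; 0, 0] := by
    ext i j; fin_cases i <;> fin_cases j <;> simp [Ring.lie_def]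
  have c2 : ⁅(!![1, 0; 0, 0] : Matrix (Fin 2) (Fin 2) F), (!![0, 0; 1, 0] : Matrix (Fin 2) (Fin 2) F)⁆
      = -!![0, 0; 1, 0] := by
    ext i j; fin_cases i <;> fin_cases j <;> simp [Ring.lie_def]
  have c3 : ⁅(!![0, 1; 0, 0] : Matrix (Fin 2) (Fin 2) F), (!![0, 0; 1, 0] : Matrix (Fin 2) (Fin 2) F)⁆
      = !![1, 0; 0, 0] + !![1, 0; 0, 0] - 1 := by
    ext i j; fin_cases i <;> fin_cases j <;> simp [Ring.lie_def]
  have d1 := hlie !![1, 0; 0, 0] !![0, 1; 0, 0]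
  have d2 := hlie !![1, 0; 0, 0] !![0, 0; 1, 0]
  have d3 := hlie !![0, 1; 0, 0] !![0, 0; 1, 0]
  rw [c1] at d1
  rw [c2, map_neg] at d2
  rw [c3, map_sub, map_add, hone] at d3
  have e1 := hborel !![1, 0; 0, 0] (by simp)
  have e2 := hborel !![0, 1; 0, 0] (by simp)
  have hX : θ !![0, 1; 0, 0] ≠ 0 := fun h => by
    have := congrFun (congrFun (hinj (h.trans (map_zero θ).symm)) 0) 1
    simp at this
  have hM : ∀ M : Matrix (Fin 2) (Fin 2) F, M = (M 0 0 - M 1 1) • !![1, 0; 0, 0]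
      + M 0 1 • !![0, 1; 0, 0] + M 1 0 • !![0, 0; 1, 0] + M 1 1 • (1 : Matrix (Fin 2) (Fin 2) F) := by
    intro M
    ext i j; fin_cases i <;> fin_cases j <;> simp
  have hθ : ∀ M : Matrix (Fin 2) (Fin 2) F, θ M = (M 0 0 - M 1 1) • θ !![1, 0; 0, 0]
      + M 0 1 • θ !![0, 1; 0, 0] + M 1 0 • θ !![0, 0; 1, 0] + M 1 1 • (1 : Matrix (Fin 2) (Fin 2) F) := by
    intro M
    conv_lhs => rw [hM M]
    simp only [map_add, map_smul, hone]
  generalize θ !![1, 0; 0, 0] = A at *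
  generalize θ !![0, 1; 0, 0] = X at *
  generalize θ !![0, 0; 1, 0] = Y at *
  have x00 := congrFun (congrFun d1 0) 0
  have x01 := congrFun (congrFun d1 0) 1
  have x11 := congrFun (congrFun d1 1) 1
  simp [Ring.lie_def, Matrix.mul_apply, Fin.sum_univ_two, e1, e2] at x00 x01 x11
  have hX00 : X 0 0 = 0 := by linear_combination x00
  have hX11 : X 1 1 = 0 := by linear_combination x11
  have hX01 : X 0 1 ≠ 0 := fun h => hX (by ext i j; fin_cases i <;> fin_cases j <;> simp [hX00, hX11, e2, h])
  have hA : A 0 0 = 1 + A 1 1 := by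
    rw [hX00, hX11] at x01
    have : X 0 1 * (A 0 0 - A 1 1 - 1) = 0 := by linear_combination -x01
    linear_combination (mul_eq_zero.1 this).resolve_left hX01
  have hA11 := hdiag hA
  rw [hA11, add_zero] at hA
  have y00 := congrFun (congrFun d2 0) 0
  have y01 := congrFun (congrFun d2 0) 1
  have z00 := congrFun (congrFun d3 0) 0
  have z01 := congrFun (congrFun d3 0) 1
  have y11 := congrFun (congrFun d2 1) 1
  simp [Ring.lie_def, Matrix.mul_apply, Fin.sum_univ_two, e1, e2, hX00, hX11, hA, hA11]
    at y00 y01 y11 z00 z01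
  have hY10 : Y 1 0 = (X 0 1)⁻¹ := by
    field_simp
    linear_combination -z00
  refine ⟨!![1, -A 0 1 * (X 0 1)⁻¹; 0, (X 0 1)⁻¹], ?_, ?_, ?_⟩
  · simp [det_fin_two, hX01]
  · ext i; fin_cases i <;> simp [vone]
  · have hY00 : Y 0 0 = -A 0 1 * (X 0 1)⁻¹ := by rw [← hY10]; linear_combination -y00
    have hY11 : Y 1 1 = A 0 1 * (X 0 1)⁻¹ := by rw [← hY10]; linear_combination y11
    have hY01 : Y 0 1 = -A 0 1 ^ 2 * (X 0 1)⁻¹ := by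
      rw [hY00, hY11] at y01
      linear_combination (-1 / 2) * y01
    intro M
    rw [hθ M]
    ext i j
    fin_cases i <;> fin_cases j <;>
      simp [Matrix.mul_apply, Fin.sum_univ_two, e1, e2, hX00, hX11, hA, hA11, hY00, hY01, hY10,
        hY11] <;> field_simp <;> ring

lemma PsiMap_act {f : V2 F ≃ₗ[F] V2 F} {M N : Matrix (Fin 2) (Fin 2) F}
    (h : ∀ x, M *ᵥ f x = f (N *ᵥ x)) (B : WW F) :
    PsiMap F f (act N B) = act M (PsiMap F f B) := by
  have h' : ∀ x, f.symm (M *ᵥ x) = N *ᵥ f.symm x := fun x => by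
    rw [LinearEquiv.symm_apply_eq, ← h, LinearEquiv.apply_symm_apply]
  refine LinearMap.ext fun x => LinearMap.ext fun y => ?_
  simp only [act_apply, PsiMap_apply, map_sub, h, h']

lemma IsMulHom.exists_eq_PsiMap (hg : IsMulHom g) :
    ∃ f : V2 F ≃ₗ[F] V2 F, f (vone F) = vone F ∧ ∀ A : W2span F, (g A).1 = PsiMap F f A.1 := by
  obtain ⟨P, hP, hP1, hθ⟩ := exists_conj (theta g) hg.theta_lie hg.theta_injective hg.theta_one
    (fun _ => hg.theta_apply_one_zero) hg.theta_diag
  let f : V2 F ≃ₗ[F] V2 F := P.toLinearEquiv (Pi.basisFun F (Fin 2)) hP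
  have hf : ∀ x, f x = P *ᵥ x := fun x => by
    simp [f, Matrix.toLinearEquiv, ← Matrix.toLin'_apply, Matrix.toLin_eq_toLin']
  have hf1 : f (vone F) = vone F := by rw [hf, hP1]
  have hconj : ∀ M x, theta g M *ᵥ f x = f (M *ᵥ x) := fun M x => by
    rw [hf, hf, mulVec_mulVec, hθ, mulVec_mulVec]
  have hone : ∀ (B : W2span F) (y : V2 F),
      (g B).1 (vone F) y = PsiMap F f B.1 (vone F) y := by
    intro B y
    obtain ⟨x, rfl⟩ := f.surjective y
    rw [← rho_mulVec, ← hg.theta_rho, hconj, rho_mulVec, PsiMap_apply, f.symm_apply_apply,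
      f.symm_apply_eq.2 hf1.symm]
  obtain ⟨L, hL⟩ := LinearMap.injective_iff_surjective.1 hg.theta_injective !![0, 0; 1, 0]
  have hL1 : theta g L *ᵥ vone F = vtwo F := by
    rw [hL]
    ext i; fin_cases i <;> simp [vone, vtwo]
  refine ⟨f, hf1, fun B => ?_⟩
  have htwo : ∀ y, (g B).1 (vtwo F) y = PsiMap F f B.1 (vtwo F) y := by
    intro y
    have h := hone (symAct L B) y
    rw [hg.map_act] at h
    change _ = PsiMap F f (act L B.1) (vone F) y at h
    rw [PsiMap_act (hconj L), act_apply, act_apply, hone, hone, hL1] at h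
    exact sub_right_injective (sub_left_injective h)
  refine LinearMap.ext fun x => LinearMap.ext fun y => ?_
  rw [eq_smul_add_smul x]
  simp only [map_add, map_smul, LinearMap.add_apply, LinearMap.smul_apply, hone, htwo]

lemma PsiMap_injOn {f f' : V2 F ≃ₗ[F] V2 F} (hf : f (vone F) = vone F)
    (hf' : f' (vone F) = vone F) (h : ∀ A ∈ W2span F, PsiMap F f A = PsiMap F f' A) : f = f' := by
  refine LinearEquiv.ext fun u => ?_
  have hu := LinearMap.congr_fun
    (LinearMap.congr_fun (h (symOf u 0 0) (symOf_mem _ _ _)) (vone F)) (vone F)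
  simpa [PsiMap_apply, f.symm_apply_eq.2 hf.symm, f'.symm_apply_eq.2 hf'.symm, symOf_apply,
    vone_apply_zero, vone_apply_one] using hu

end

/-- Φ(f) maps W₂ onto itself, and the induced homomorphism GL(V₂,v₁) → Aut(W₂)
is bijective. -/
theorem statement13 :
    (∀ f : V2 F ≃ₗ[F] V2 F, f (vone F) = vone F →
        Submodule.map (PsiMap F f).toLinearMap (W2span F) = W2span F) ∧
    (∀ g : W2span F ≃ₗ[F] W2span F,
        (∀ a b c : W2span F, wmul F a.1 b.1 = c.1 →
            wmul F (g a).1 (g b).1 = (g c).1) →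
        ∃! f : V2 F ≃ₗ[F] V2 F, f (vone F) = vone F ∧
          ∀ A : W2span F, ((g A : W2span F) : WW F) = PsiMap F f (A : WW F)) := by
  refine ⟨fun f _ => map_PsiMap_W2span f, fun g hg => ?_⟩
  obtain ⟨f, hf, hgf⟩ := IsMulHom.exists_eq_PsiMap hg
  refine ⟨f, ⟨hf, hgf⟩, fun f' ⟨hf', hgf'⟩ => PsiMap_injOn hf' hf fun A hA => ?_⟩
  rw [← hgf' ⟨A, hA⟩, ← hgf ⟨A, hA⟩]

end
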